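/- arXiv:1807.08780 — 4 statements merged into one kernel-verified Lean document; each statement's English description precedes it below -/
import Mathlib

section
/- In the setting of the context, let ν be a fully homogeneous valuation on R. Let c₁, …, c_r ∈ ℤᵐ be nonzero vectors and let H ⊆ ℝᵐ be the intersection of the rational hyperplanes {x ∈ ℝᵐ : ⟨cᵢ, x⟩ = 0}, i = 1, …, r. Let ω(R) ⊆ ℝᵐ be the ℝ≥0-span of the images of the weights {u ∈ ℤᵐ : 𝒜 u ≠ 0}, and assume H meets the relative interior (intrinsic interior) of ω(R). Let U := {u ∈ ℤᵐ : 𝒜 u ≠ 0 and ⟨cᵢ, u⟩ = 0 for all i}, let R' := R(U) be the corresponding Veronese subalgebra, and let ω(R') ⊆ ℝᵐ be the ℝ≥0-span of the image of U. Then C(R', ν) = π⁻¹(ω(R')) ∩ C(R, ν). (Lemma 3.4 of the paper.) -/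
open scoped NNReal

noncomputable section

/-- The coordinatewise embedding of `Γ = ℤᵐ × ℤⁿ` into `ℝᵐ × ℝⁿ`. -/
def embG (m n : ℕ) : (Fin m → ℤ) × (Fin n → ℤ) → (Fin m → ℝ) × (Fin n → ℝ) :=
  fun v => (fun i => ((v.1 i : ℤ) : ℝ), fun j => ((v.2 j : ℤ) : ℝ))

/-- The coordinatewise embedding of `ℤᵐ` into `ℝᵐ`. -/
def embM (m : ℕ) : (Fin m → ℤ) → (Fin m → ℝ) := fun u i => ((u i : ℤ) : ℝ)

variable {K R : Type} [Field K] [IsAlgClosed K] [CommRing R] [IsDomain R] [Algebra K R]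
variable {m n : ℕ}

/-- The value semigroup `ν(A \ {0})` of a valuation on the subset `A ⊆ R`. -/
def valueSemigroup (ν : R → (Fin m → ℤ) × (Fin n → ℤ)) (A : Set R) :
    AddSubmonoid ((Fin m → ℤ) × (Fin n → ℤ)) :=
  AddSubmonoid.closure (ν '' {f | f ∈ A ∧ f ≠ 0})

/-- The valuation cone: the topological closure in `ℝᵐ × ℝⁿ` of the `ℝ≥0`-span of the image
of the value semigroup. -/
def valuationCone (ν : R → (Fin m → ℤ) × (Fin n → ℤ)) (A : Set R) :
    Set ((Fin m → ℝ) × (Fin n → ℝ)) :=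
  closure (Submodule.span ℝ≥0 (embG m n '' (valueSemigroup ν A : Set _)) : Set _)

/-- The Veronese subalgebra `R(U)` associated to a set of degrees `U ⊆ ℤᵐ`. -/
def veronese (𝒜 : (Fin m → ℤ) → Submodule K R) (U : Set (Fin m → ℤ)) : Subalgebra K R :=
  Algebra.adjoin K (⋃ u ∈ U, (𝒜 u : Set R))

theorem exists_ratLinearMap_pos (t : Finset ℝ) (ht : ∀ a ∈ t, 0 < a) :
    ∃ φ : ℝ →ₗ[ℚ] ℚ, ∀ a ∈ t, 0 < φ a := by
  let B := Module.Basis.ofVectorSpace ℚ ℝ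
  let O : Set (Module.Basis.ofVectorSpaceIndex ℚ ℝ → ℝ) :=
    ⋂ a ∈ t, {e | 0 < ∑ i ∈ (B.repr a).support, ((B.repr a i : ℚ) : ℝ) * e i}
  have hO : IsOpen O := isOpen_biInter_finset fun a _ =>
    isOpen_lt continuous_const (by fun_prop)
  have hne : O.Nonempty := by
    refine ⟨fun i => B i, Set.mem_iInter₂.2 fun a ha => ?_⟩
    have h := B.linearCombination_repr a
    rw [Finsupp.linearCombination_apply, Finsupp.sum] at h
    simp only [Rat.smul_def] at h
    simpa only [Set.mem_ofPred_eq, h] using ht a ha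
  obtain ⟨e, he⟩ := (DenseRange.piMap
    fun _ : Module.Basis.ofVectorSpaceIndex ℚ ℝ => Rat.denseRange_cast (𝕜 := ℝ)).exists_mem_open
      hO hne
  refine ⟨B.constr ℚ e, fun a ha => ?_⟩
  have h := Set.mem_iInter₂.1 he a ha
  rw [Module.Basis.constr_apply, Finsupp.sum]
  simp only [Set.mem_ofPred_eq, Pi.map_apply] at h
  simp only [smul_eq_mul]
  exact_mod_cast h

/-- An integral homogeneous linear system with a positive real solution has a positive integral
solution. -/
theorem exists_nat_pos_solution {ι κ : Type*} (t : Finset κ) (a : κ → ℝ) (ha : ∀ i ∈ t, 0 < a i)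
    (l : ι → κ → ℤ) (hl : ∀ j, ∑ i ∈ t, a i * (l j i : ℝ) = 0) :
    ∃ b : κ → ℕ, (∀ i ∈ t, 0 < b i) ∧ ∀ j, ∑ i ∈ t, (b i : ℤ) * l j i = 0 := by
  classical
  obtain ⟨φ, hφ⟩ := exists_ratLinearMap_pos (t.image a) (by simpa using ha)
  replace hφ : ∀ i ∈ t, 0 < φ (a i) := fun i hi => hφ _ (Finset.mem_image_of_mem a hi)
  set N : ℕ := ∏ i ∈ t, (φ (a i)).den
  have hN : 0 < N := Finset.prod_pos fun i _ => (φ (a i)).den_pos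
  have hint : ∀ i, ∃ z : ℕ, i ∈ t → (z : ℚ) = N * φ (a i) := fun i => by
    by_cases hi : i ∈ t
    · obtain ⟨k, hk⟩ : (φ (a i)).den ∣ N := Finset.dvd_prod_of_mem _ hi
      refine ⟨(φ (a i)).num.toNat * k, fun _ => ?_⟩
      have hnum : (((φ (a i)).num.toNat : ℤ) : ℚ) = (φ (a i)).num := by
        rw [Int.toNat_of_nonneg (Rat.num_nonneg.2 (hφ i hi).le)]
      rw [Int.cast_natCast, ← Rat.den_mul_eq_num] at hnum
      rw [hk, Nat.cast_mul, Nat.cast_mul, hnum]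
      ring
    · exact ⟨0, fun h => absurd h hi⟩
  choose b hb using hint
  refine ⟨b, fun i hi => ?_, fun j => ?_⟩
  · have : (0 : ℚ) < b i := by
      rw [hb i hi]
      exact mul_pos (by exact_mod_cast hN) (hφ i hi)
    exact_mod_cast this
  · have h : φ (∑ i ∈ t, a i * (l j i : ℝ)) = 0 := by rw [hl, map_zero]
    have h' : ∀ i, φ (a i * (l j i : ℝ)) = φ (a i) * l j i := fun i => by
      rw [mul_comm, ← zsmul_eq_mul, map_zsmul, zsmul_eq_mul, mul_comm]
    rw [map_sum] at h
    simp only [h'] at h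
    have : ∑ i ∈ t, (b i : ℚ) * (l j i : ℚ) = 0 := by
      rw [Finset.sum_congr rfl fun i hi => by rw [hb i hi, mul_assoc], ← Finset.mul_sum, h,
        mul_zero]
    exact_mod_cast this

/-- The ratio test: move from a nonnegative vector along `-b` until a coordinate vanishes. -/
theorem exists_sub_mul_nonneg {κ : Type*} (t : Finset κ) (a b : κ → ℝ) (ha : ∀ i ∈ t, 0 ≤ a i)
    (hb : ∃ i ∈ t, 0 < b i) :
    ∃ τ : ℝ, 0 ≤ τ ∧ (∀ i ∈ t, 0 ≤ a i - τ * b i) ∧ ∃ i ∈ t, a i - τ * b i = 0 := by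
  obtain ⟨i₁, hi₁, hbi₁⟩ := hb
  obtain ⟨i₀, hi₀, hmin⟩ := Finset.exists_min_image (t.filter fun i => 0 < b i)
    (fun i => a i / b i) ⟨i₁, Finset.mem_filter.2 ⟨hi₁, hbi₁⟩⟩
  obtain ⟨hi₀, hbi₀⟩ := Finset.mem_filter.1 hi₀
  have hτ : 0 ≤ a i₀ / b i₀ := div_nonneg (ha _ hi₀) hbi₀.le
  refine ⟨a i₀ / b i₀, hτ, fun i hi => ?_, i₀, hi₀, ?_⟩
  · rcases le_or_gt (b i) 0 with h | h
    · nlinarith [ha i hi, mul_nonneg hτ (neg_nonneg.2 h)]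
    · have := hmin i (Finset.mem_filter.2 ⟨hi, h⟩)
      rw [le_div_iff₀ h] at this
      linarith
  · rw [div_mul_cancel₀ _ hbi₀.ne', sub_self]

theorem smul_mem_of_nonneg {E : Type*} [AddCommGroup E] [Module ℝ E] (C : Submodule ℝ≥0 E)
    {a : ℝ} (ha : 0 ≤ a) {x : E} (hx : x ∈ C) : a • x ∈ C :=
  C.smul_mem (⟨a, ha⟩ : ℝ≥0) hx

theorem sum_smul_mem_span_section {G E ι κ : Type*} [AddCommMonoid G] [AddCommGroup E]
    [Module ℝ E] (S : AddSubmonoid G) (e : G →+ E) (l : ι → G →+ ℤ) (t : Finset κ)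
    (s : κ → G) (hs : ∀ i ∈ t, s i ∈ S) (a : κ → ℝ) (ha : ∀ i ∈ t, 0 ≤ a i)
    (hl : ∀ j, ∑ i ∈ t, a i * (l j (s i) : ℝ) = 0) :
    ∑ i ∈ t, a i • e (s i) ∈ Submodule.span ℝ≥0 (e '' {g | g ∈ S ∧ ∀ j, l j g = 0}) := by
  classical
  induction t using Finset.strongInduction generalizing a with
  | H t ih =>
    have drop : ∀ a : κ → ℝ, (∀ i ∈ t, 0 ≤ a i) → (∀ j, ∑ i ∈ t, a i * (l j (s i) : ℝ) = 0) →
        (∃ i ∈ t, a i = 0) →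
        ∑ i ∈ t, a i • e (s i) ∈ Submodule.span ℝ≥0 (e '' {g | g ∈ S ∧ ∀ j, l j g = 0}) := by
      rintro a ha hl ⟨i₀, hi₀, h0⟩
      rw [← Finset.sum_erase (a := i₀) t (by rw [h0, zero_smul])]
      refine ih _ (Finset.erase_ssubset hi₀) (fun i hi => hs i (Finset.mem_of_mem_erase hi)) a
        (fun i hi => ha i (Finset.mem_of_mem_erase hi)) fun j => ?_
      rw [Finset.sum_erase (a := i₀) t (by rw [h0, zero_mul]), hl]
    rcases t.eq_empty_or_nonempty with rfl | ⟨i₁, hi₁⟩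
    · simp
    by_cases hz : ∃ i ∈ t, a i = 0
    · exact drop a ha hl hz
    push Not at hz
    obtain ⟨b, hb, hbl⟩ := exists_nat_pos_solution t a
      (fun i hi => (ha i hi).lt_of_ne (hz i hi).symm) (fun j i => l j (s i)) hl
    obtain ⟨τ, hτ, hnn, hzero⟩ := exists_sub_mul_nonneg t a (fun i => (b i : ℝ)) ha
      ⟨i₁, hi₁, by exact_mod_cast hb i₁ hi₁⟩
    have hbl' : ∀ j, ∑ i ∈ t, (b i : ℝ) * (l j (s i) : ℝ) = 0 := fun j => by
      exact_mod_cast hbl j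
    have hrest := drop (fun i => a i - τ * b i) hnn (fun j => by
      simp only [sub_mul, Finset.sum_sub_distrib, mul_assoc, ← Finset.mul_sum]
      rw [hl, hbl', mul_zero, sub_zero]) hzero
    have hmem : e (∑ i ∈ t, b i • s i) ∈
        Submodule.span ℝ≥0 (e '' {g | g ∈ S ∧ ∀ j, l j g = 0}) := by
      refine Submodule.subset_span ⟨_, ⟨sum_mem fun i hi => S.nsmul_mem (hs i hi) _,
        fun j => ?_⟩, rfl⟩
      simpa using hbl j
    have hsum : ∑ i ∈ t, a i • e (s i) =
        ∑ i ∈ t, (a i - τ * b i) • e (s i) + τ • e (∑ i ∈ t, b i • s i) := by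
      rw [map_sum, Finset.smul_sum, ← Finset.sum_add_distrib]
      refine Finset.sum_congr rfl fun i _ => ?_
      rw [map_nsmul, ← Nat.cast_smul_eq_nsmul ℝ, smul_smul, ← add_smul, sub_add_cancel]
    rw [hsum]
    exact add_mem hrest (smul_mem_of_nonneg _ hτ hmem)

/-- The section of the cone over a semigroup by a rational subspace is the cone over the section
of the semigroup. -/
theorem mem_span_section {G E ι : Type*} [AddCommMonoid G] [AddCommGroup E]
    [Module ℝ E] (S : AddSubmonoid G) (e : G →+ E) (l : ι → G →+ ℤ) (L : ι → E →ₗ[ℝ] ℝ)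
    (hL : ∀ j g, L j (e g) = l j g) {x : E} (hx : x ∈ Submodule.span ℝ≥0 (e '' (S : Set G)))
    (hx0 : ∀ j, L j x = 0) :
    x ∈ Submodule.span ℝ≥0 (e '' {g | g ∈ S ∧ ∀ j, l j g = 0}) := by
  obtain ⟨N, f, g, rfl⟩ := Submodule.mem_span_set'.1 hx
  have hg : ∀ i, ∃ s ∈ S, e s = (g i : E) := fun i => (g i).2
  choose s hs hsg using hg
  simp only [← hsg, NNReal.smul_def] at hx0 ⊢
  refine sum_smul_mem_span_section S e l Finset.univ s (fun i _ => hs i) (fun i => (f i : ℝ))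
    (fun i _ => (f i).2) fun j => ?_
  simpa [hL] using hx0 j

/-- Carathéodory's theorem for cones. -/
theorem exists_linearIndepOn_mem_span {E : Type*} [AddCommGroup E] [Module ℝ E] (t : Finset E)
    (a : E → ℝ) (ha : ∀ i ∈ t, 0 ≤ a i) :
    ∃ t' ⊆ t, LinearIndepOn ℝ id (t' : Set E) ∧ ∃ b : E → ℝ, (∀ i ∈ t', 0 ≤ b i) ∧
      ∑ i ∈ t', b i • i = ∑ i ∈ t, a i • i := by
  classical
  induction t using Finset.strongInduction generalizing a with
  | H t ih =>
    by_cases hind : LinearIndepOn ℝ id (t : Set E)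
    · exact ⟨t, subset_rfl, hind, a, ha, rfl⟩
    rw [linearIndepOn_finset_iff] at hind
    push Not at hind
    obtain ⟨g, hg, i₁, hi₁, hne⟩ := hind
    simp only [id] at hg
    obtain ⟨b, hb, hbpos⟩ : ∃ b : E → ℝ, ∑ i ∈ t, b i • i = 0 ∧ ∃ i ∈ t, 0 < b i := by
      rcases hne.lt_or_gt with h | h
      · exact ⟨fun i => - g i, by simp [hg], i₁, hi₁, neg_pos.2 h⟩
      · exact ⟨g, hg, i₁, hi₁, h⟩
    obtain ⟨τ, -, hnn, i₀, hi₀, hzero⟩ := exists_sub_mul_nonneg t a b ha hbpos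
    obtain ⟨t', ht', hli, c, hc, hsum⟩ := ih _ (Finset.erase_ssubset hi₀) (fun i => a i - τ * b i)
      fun i hi => hnn i (Finset.mem_of_mem_erase hi)
    refine ⟨t', ht'.trans (Finset.erase_subset _ _), hli, c, hc, ?_⟩
    rw [hsum, Finset.sum_erase t (by rw [hzero, zero_smul])]
    simp only [sub_smul, mul_smul, Finset.sum_sub_distrib, ← Finset.smul_sum, hb, smul_zero,
      sub_zero]

theorem isClosed_span_nnreal_finset {E : Type*} [NormedAddCommGroup E] [NormedSpace ℝ E]
    (t : Finset E) : IsClosed (Submodule.span ℝ≥0 (t : Set E) : Set E) := by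
  classical
  let F : Finset E → Set E := fun s =>
    (fun b : s → ℝ => ∑ i : s, b i • (i : E)) '' {b | ∀ i, 0 ≤ b i}
  have hF : ∀ s : Finset E, LinearIndepOn ℝ id (s : Set E) → IsClosed (F s) := fun s hs => by
    have hinj : Function.Injective (Fintype.linearCombination ℝ (fun i : s => (i : E))) :=
      LinearIndependent.fintypeLinearCombination_injective hs
    have hcl := LinearMap.isClosedEmbedding_of_injective (LinearMap.ker_eq_bot.2 hinj)
    have hset : IsClosed {b : s → ℝ | ∀ i, 0 ≤ b i} := by
      simp only [Set.ofPred_forall]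
      exact isClosed_iInter fun i => isClosed_le continuous_const (continuous_apply i)
    exact hcl.isClosedMap _ hset
  have hEq : (Submodule.span ℝ≥0 (t : Set E) : Set E) =
      ⋃ s ∈ t.powerset.filter fun s : Finset E => LinearIndepOn ℝ id (s : Set E), F s := by
    ext x
    simp only [Set.mem_iUnion, Finset.mem_filter, Finset.mem_powerset, SetLike.mem_coe]
    constructor
    · intro hx
      obtain ⟨f, -, rfl⟩ := Submodule.mem_span_finset.1 hx
      obtain ⟨t', ht', hli, b, hb, hsum⟩ := exists_linearIndepOn_mem_span t (fun i => (f i : ℝ))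
        fun i _ => (f i).2
      refine ⟨t', ⟨ht', hli⟩, fun i => b i, fun i => hb i i.2, ?_⟩
      rw [← Finset.sum_coe_sort] at hsum
      exact hsum
    · rintro ⟨s, ⟨hs, -⟩, b, hb, rfl⟩
      exact sum_mem fun i _ => smul_mem_of_nonneg _ (hb i) (Submodule.subset_span (hs i.2))
  rw [hEq]
  exact isClosed_biUnion_finset fun s hs => hF s (Finset.mem_filter.1 hs).2

/-- A relative interior direction of a cone: adding a positive multiple of it moves the closure
of the cone into the cone. -/
theorem exists_add_smul_mem_span {E : Type*} [NormedAddCommGroup E] [NormedSpace ℝ E]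
    [FiniteDimensional ℝ E] (T : Set E) :
    ∃ p ∈ Submodule.span ℝ≥0 T, ∀ q ∈ closure (Submodule.span ℝ≥0 T : Set E), ∀ ε : ℝ, 0 < ε →
      q + ε • p ∈ Submodule.span ℝ≥0 T := by
  obtain ⟨b, hbT, hspan, hli⟩ := exists_linearIndependent ℝ T
  have : Finite b := hli.finite
  have := Fintype.ofFinite b
  let Φ := Fintype.linearCombination ℝ (fun i : b => (i : E))
  have hcl : Topology.IsClosedEmbedding Φ := LinearMap.isClosedEmbedding_of_injective
    (LinearMap.ker_eq_bot.2 hli.fintypeLinearCombination_injective)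
  have hnn : ∀ y : b → ℝ, (∀ i, 0 ≤ y i) → Φ y ∈ Submodule.span ℝ≥0 T := fun y hy =>
    sum_mem fun i _ => smul_mem_of_nonneg _ (hy i) (Submodule.subset_span (hbT i.2))
  have hrange : (Submodule.span ℝ≥0 T : Set E) ⊆ Set.range Φ := by
    have h : Set.range Φ = (Submodule.span ℝ T : Set E) := by
      rw [← hspan, ← LinearMap.coe_range, Fintype.range_linearCombination, Subtype.range_coe]
    rw [h]
    exact Submodule.span_le_restrictScalars ℝ≥0 ℝ T
  refine ⟨Φ 1, hnn 1 fun _ => zero_le_one, fun q hq ε hε => ?_⟩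
  obtain ⟨y, rfl⟩ := closure_minimal hrange hcl.isClosed_range hq
  have hy : y ∈ closure (Φ ⁻¹' (Submodule.span ℝ≥0 T : Set E)) := by
    rw [hcl.isInducing.closure_eq_preimage_closure_image, Set.image_preimage_eq_of_subset hrange]
    exact hq
  obtain ⟨y', hy', hdist⟩ := Metric.mem_closure_iff.1 hy ε hε
  have hdecomp : Φ y + ε • Φ 1 = Φ y' + Φ (y - y' + ε • 1) := by
    rw [← map_smul, ← map_add, ← map_add]
    congr 1
    abel
  rw [hdecomp]
  refine add_mem hy' (hnn _ fun i => ?_)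
  have h := (dist_le_pi_dist y y' i).trans_lt hdist
  rw [Real.dist_eq, abs_lt] at h
  simp only [Pi.add_apply, Pi.sub_apply, Pi.smul_apply, Pi.one_apply, smul_eq_mul, mul_one]
  linarith

theorem exists_sub_smul_mem_of_mem_intrinsicInterior {E : Type*} [NormedAddCommGroup E]
    [NormedSpace ℝ E] (C : Submodule ℝ≥0 E) {x w : E} (hx : x ∈ intrinsicInterior ℝ (C : Set E))
    (hw : w ∈ C) : ∃ δ : ℝ, 0 < δ ∧ x - δ • w ∈ C := by
  obtain ⟨y, hy, rfl⟩ := mem_intrinsicInterior.1 hx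
  have hdir : w ∈ (affineSpan ℝ (C : Set E)).direction := by
    have := AffineSubspace.vsub_mem_direction (subset_affineSpan ℝ _ hw)
      (subset_affineSpan ℝ _ C.zero_mem)
    simpa using this
  have hmem : ∀ δ : ℝ, (y : E) - δ • w ∈ affineSpan ℝ (C : Set E) := fun δ => by
    have := AffineSubspace.vadd_mem_of_mem_direction
      (Submodule.smul_mem _ (-δ) hdir) y.2
    rwa [vadd_eq_add, neg_smul, neg_add_eq_sub] at this
  let γ : ℝ → affineSpan ℝ (C : Set E) := fun δ => ⟨(y : E) - δ • w, hmem δ⟩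
  have hγ : Continuous γ := by
    refine Continuous.subtype_mk ?_ _
    fun_prop
  have hγ0 : γ 0 = y := Subtype.ext (by simp [γ])
  have hnhds := (isOpen_interior.preimage hγ).mem_nhds
    (show (0 : ℝ) ∈ γ ⁻¹' interior _ by rw [Set.mem_preimage, hγ0]; exact hy)
  obtain ⟨ε, hε, hball⟩ := Metric.mem_nhds_iff.1 hnhds
  have hin : ε / 2 ∈ Metric.ball (0 : ℝ) ε := by
    rw [Metric.mem_ball, Real.dist_eq, sub_zero, abs_of_pos (half_pos hε)]
    exact half_lt_self hε
  exact ⟨ε / 2, half_pos hε, interior_subset (s := Subtype.val ⁻¹' (C : Set E)) (hball hin)⟩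

theorem decompose_eq_zero_of_mem_adjoin {K R M : Type*} [Field K] [CommRing R] [Algebra K R]
    [AddCommMonoid M] [DecidableEq M] (𝒜 : M → Submodule K R) [GradedAlgebra 𝒜]
    (D : AddSubmonoid M) (X : Set R)
    (hX : ∀ x ∈ X, ∀ u ∉ D, ((DirectSum.decompose 𝒜 x u : 𝒜 u) : R) = 0) {f : R}
    (hf : f ∈ Algebra.adjoin K X) : ∀ u ∉ D, ((DirectSum.decompose 𝒜 f u : 𝒜 u) : R) = 0 := by
  classical
  induction hf using Algebra.adjoin_induction with
  | mem x hx => exact hX x hx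
  | algebraMap k =>
    intro u hu
    exact DirectSum.decompose_of_mem_ne 𝒜 (SetLike.algebraMap_mem_graded 𝒜 k)
      fun h => hu (h ▸ D.zero_mem)
  | add x y _ _ hx hy =>
    intro u hu
    simp [DirectSum.decompose_add, hx u hu, hy u hu]
  | mul x y _ _ hx hy =>
    intro u hu
    rw [DirectSum.decompose_mul, DirectSum.coe_mul_apply]
    refine Finset.sum_eq_zero fun ij hij => ?_
    have hsum := (Finset.mem_filter.1 hij).2
    by_cases h1 : ij.1 ∈ D
    · rw [hy ij.2 fun h2 => hu (hsum ▸ D.add_mem h1 h2), mul_zero]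
    · rw [hx _ h1, zero_mul]

/-- The weights of a finitely generated graded algebra lie in a finitely generated monoid of
weights. -/
theorem exists_finset_weights_subset_closure {K R M : Type*} [Field K] [CommRing R] [Algebra K R]
    [AddCommMonoid M] [DecidableEq M] (𝒜 : M → Submodule K R) [GradedAlgebra 𝒜]
    (hfg : Algebra.FiniteType K R) :
    ∃ t : Finset M, (∀ u ∈ t, 𝒜 u ≠ ⊥) ∧ {u | 𝒜 u ≠ ⊥} ⊆ AddSubmonoid.closure (t : Set M) := by
  classical
  obtain ⟨X, hX⟩ := hfg.out
  refine ⟨X.biUnion fun x => (DirectSum.decompose 𝒜 x).support, fun u hu hbot => ?_,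
    fun u hu => ?_⟩
  · obtain ⟨x, -, hx⟩ := Finset.mem_biUnion.1 hu
    refine DFinsupp.mem_support_iff.1 hx (Subtype.ext ?_)
    exact (Submodule.mem_bot K).1 (hbot.le (DirectSum.decompose 𝒜 x u).2)
  · by_contra hnot
    obtain ⟨f, hf, hne⟩ := (Submodule.ne_bot_iff _).1 hu
    refine hne ?_
    rw [← DirectSum.decompose_of_mem_same 𝒜 hf]
    refine decompose_eq_zero_of_mem_adjoin 𝒜 _ (X : Set R) (fun x hx v hv => ?_)
      (hX ▸ Algebra.mem_top : f ∈ Algebra.adjoin K (X : Set R)) u hnot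
    by_contra hxv
    refine hv (AddSubmonoid.subset_closure (Finset.mem_biUnion.2 ⟨x, hx, ?_⟩))
    exact DFinsupp.mem_support_iff.2 fun h => hxv (by rw [h]; rfl)

/-- `embG` as an additive homomorphism. -/
def embGHom (m n : ℕ) : (Fin m → ℤ) × (Fin n → ℤ) →+ (Fin m → ℝ) × (Fin n → ℝ) where
  toFun := embG m n
  map_zero' := by ext <;> simp [embG]
  map_add' _ _ := by ext <;> simp [embG]

/-- `embM` as an additive homomorphism. -/
def embMHom (m : ℕ) : (Fin m → ℤ) →+ (Fin m → ℝ) where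
  toFun := embM m
  map_zero' := by ext; simp [embM]
  map_add' _ _ := by ext; simp [embM]

/-- Pairing with an integral vector. -/
def pairZ (c : Fin m → ℤ) : (Fin m → ℤ) →+ ℤ where
  toFun u := ∑ j, c j * u j
  map_zero' := by simp
  map_add' _ _ := by simp [mul_add, Finset.sum_add_distrib]

/-- Pairing of a real vector with an integral vector. -/
def pairR (c : Fin m → ℤ) : (Fin m → ℝ) →ₗ[ℝ] ℝ where
  toFun x := ∑ j, (c j : ℝ) * x j
  map_add' _ _ := by simp [mul_add, Finset.sum_add_distrib]
  map_smul' _ _ := by simp [Finset.mul_sum, mul_left_comm]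

theorem pairR_embMHom (c u : Fin m → ℤ) : pairR c (embMHom m u) = pairZ c u := by
  simp [pairR, pairZ, embMHom, embM]

/-- **Lemma 3.4.** Let `ν` be a fully homogeneous valuation on the `ℤᵐ`-graded domain `R`
with `R₀ = K`, and let `H = H₁ ∩ … ∩ H_r` be an intersection of rational hyperplanes meeting
the relative (intrinsic) interior of the weight cone `ω(R)`. Let `R'` be the Veronese
subalgebra of the weights lying on `H`. Then `C(R',ν) = π⁻¹(ω(R')) ∩ C(R,ν)`. -/
theorem valuationCone_veronese_hyperplane_section
    (𝒜 : (Fin m → ℤ) → Submodule K R) [GradedAlgebra 𝒜]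
    (hfg : Algebra.FiniteType K R)
    (h0 : 𝒜 0 = Submodule.span K {(1 : R)})
    (le : ((Fin m → ℤ) × (Fin n → ℤ)) → ((Fin m → ℤ) × (Fin n → ℤ)) → Prop)
    (hlin : IsLinearOrder _ le)
    (hinv : ∀ a b c, le a b → le (c + a) (c + b))
    (ν : R → (Fin m → ℤ) × (Fin n → ℤ))
    (hmul : ∀ f g : R, f ≠ 0 → g ≠ 0 → ν (f * g) = ν f + ν g)
    (hadd : ∀ f g : R, f ≠ 0 → g ≠ 0 → f + g ≠ 0 →
      le (ν f) (ν (f + g)) ∨ le (ν g) (ν (f + g)))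
    (hconst : ∀ c : K, c ≠ 0 → ν (algebraMap K R c) = 0)
    (hhom : ∀ f : R, f ≠ 0 →
      (∃ u, ((DirectSum.decompose 𝒜 f u : 𝒜 u) : R) ≠ 0 ∧
        ν f = ν ((DirectSum.decompose 𝒜 f u : 𝒜 u) : R)) ∧
      ∀ u, ((DirectSum.decompose 𝒜 f u : 𝒜 u) : R) ≠ 0 →
        le (ν f) (ν ((DirectSum.decompose 𝒜 f u : 𝒜 u) : R)))
    (hfullyhom : ∀ (u : Fin m → ℤ) (f : R), f ∈ 𝒜 u → f ≠ 0 → (ν f).1 = u)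
    -- the hyperplanes
    (r : ℕ) (c : Fin r → (Fin m → ℤ)) (hc : ∀ i, c i ≠ 0)
    -- `H ∩ relint ω(R) ≠ ∅`, where `H = {x | ⟨cᵢ, x⟩ = 0 ∀ i}` and `ω(R)` is the weight cone
    (hmeet : ({x : Fin m → ℝ | ∀ i, (∑ j, ((c i j : ℤ) : ℝ) * x j) = 0} ∩
        intrinsicInterior ℝ
          ((Submodule.span ℝ≥0 (embM m '' {u | 𝒜 u ≠ ⊥}) : Submodule ℝ≥0 (Fin m → ℝ)) :
            Set (Fin m → ℝ))).Nonempty) :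
    valuationCone ν
        ((veronese 𝒜 {u | 𝒜 u ≠ ⊥ ∧ ∀ i, (∑ j, c i j * u j) = 0} : Subalgebra K R) : Set R) =
      Prod.fst ⁻¹'
          ((Submodule.span ℝ≥0
              (embM m '' {u | 𝒜 u ≠ ⊥ ∧ ∀ i, (∑ j, c i j * u j) = 0}) :
            Submodule ℝ≥0 (Fin m → ℝ)) : Set (Fin m → ℝ)) ∩
        valuationCone ν (Set.univ : Set R) := by
  classical
  set P : (Fin m → ℤ) → Prop := fun u => ∀ i, (∑ j, c i j * u j) = 0
  set Ver : Set R := ((veronese 𝒜 {u | 𝒜 u ≠ ⊥ ∧ P u} : Subalgebra K R) : Set R)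
  -- the value semigroup is the set of values of homogeneous elements
  have hval : ∀ s ∈ valueSemigroup ν (Set.univ : Set R),
      ∃ u, ∃ f ∈ 𝒜 u, f ≠ 0 ∧ ν f = s := fun s hs => by
    induction hs using AddSubmonoid.closure_induction with
    | mem s hs =>
      obtain ⟨f, ⟨-, hf⟩, rfl⟩ := hs
      obtain ⟨u, hu, hν⟩ := (hhom f hf).1
      exact ⟨u, _, (DirectSum.decompose 𝒜 f u).2, hu, hν.symm⟩
    | zero =>
      refine ⟨0, 1, SetLike.GradedOne.one_mem, one_ne_zero, ?_⟩
      simpa using hconst 1 one_ne_zero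
    | add s s' _ _ hs hs' =>
      obtain ⟨u, f, hf, hf0, rfl⟩ := hs
      obtain ⟨v, g, hg, hg0, rfl⟩ := hs'
      exact ⟨u + v, f * g, SetLike.GradedMul.mul_mem hf hg, mul_ne_zero hf0 hg0, hmul f g hf0 hg0⟩
  have hvalVer : (valueSemigroup ν Ver : Set _) =
      {s | s ∈ valueSemigroup ν (Set.univ : Set R) ∧ ∀ i, pairZ (c i) s.1 = 0} := by
    ext s
    constructor
    · intro hs
      have hsub : {f | f ∈ Ver ∧ f ≠ 0} ⊆ {f : R | f ∈ (Set.univ : Set R) ∧ f ≠ 0} :=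
        fun f hf => ⟨Set.mem_univ f, hf.2⟩
      refine ⟨AddSubmonoid.closure_mono (Set.image_mono hsub) hs, ?_⟩
      change s ∈ AddSubmonoid.closure _ at hs
      induction hs using AddSubmonoid.closure_induction with
      | mem s hs =>
        obtain ⟨f, ⟨hfV, hf⟩, rfl⟩ := hs
        obtain ⟨u, hu, hν⟩ := (hhom f hf).1
        intro i
        rw [hν, hfullyhom u _ (DirectSum.decompose 𝒜 f u).2 hu]
        by_contra hne
        refine hu (decompose_eq_zero_of_mem_adjoin 𝒜 (AddMonoidHom.mker (pairZ (c i))) _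
          (fun x hx v hv => ?_) hfV u hne)
        obtain ⟨w, hw, hxw⟩ := Set.mem_iUnion₂.1 hx
        refine DirectSum.decompose_of_mem_ne 𝒜 hxw ?_
        rintro rfl
        exact hv (hw.2 i)
      | zero => simp
      | add s s' _ _ hs hs' =>
        intro i
        rw [Prod.fst_add, map_add, hs i, hs' i, add_zero]
    · rintro ⟨hs, hsc⟩
      obtain ⟨u, f, hf, hf0, rfl⟩ := hval s hs
      rw [hfullyhom u f hf hf0] at hsc
      refine AddSubmonoid.subset_closure ⟨f, ⟨Algebra.subset_adjoin ?_, hf0⟩, rfl⟩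
      exact Set.mem_iUnion₂.2 ⟨u, ⟨(Submodule.ne_bot_iff _).2 ⟨f, hf, hf0⟩, hsc⟩, hf⟩
  have hfst : Prod.fst '' (valueSemigroup ν (Set.univ : Set R) : Set ((Fin m → ℤ) × (Fin n → ℤ))) =
      {u | 𝒜 u ≠ ⊥} := by
    ext u
    constructor
    · rintro ⟨s, hs, rfl⟩
      obtain ⟨u, f, hf, hf0, rfl⟩ := hval s hs
      rw [hfullyhom u f hf hf0]
      exact (Submodule.ne_bot_iff _).2 ⟨f, hf, hf0⟩
    · intro hu
      obtain ⟨f, hf, hf0⟩ := (Submodule.ne_bot_iff _).1 hu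
      exact ⟨ν f, AddSubmonoid.subset_closure ⟨f, ⟨Set.mem_univ f, hf0⟩, rfl⟩,
        hfullyhom u f hf hf0⟩
  let W : AddSubmonoid (Fin m → ℤ) :=
    (valueSemigroup ν (Set.univ : Set R)).map (AddMonoidHom.fst _ _)
  have hW : (W : Set (Fin m → ℤ)) = {u | 𝒜 u ≠ ⊥} := hfst
  let π : ((Fin m → ℝ) × (Fin n → ℝ)) →ₗ[ℝ≥0] (Fin m → ℝ) := LinearMap.fst ℝ≥0 _ _
  set σ : Submodule ℝ≥0 ((Fin m → ℝ) × (Fin n → ℝ)) :=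
    Submodule.span ℝ≥0 (embG m n '' (valueSemigroup ν (Set.univ : Set R) : Set _)) with hσ
  set ω : Submodule ℝ≥0 (Fin m → ℝ) := Submodule.span ℝ≥0 (embM m '' {u | 𝒜 u ≠ ⊥}) with hω
  have hmap : σ.map π = ω := by
    rw [hσ, Submodule.map_span, hω, ← hfst, Set.image_image, Set.image_image]
    rfl
  have hωclosed : IsClosed (ω : Set (Fin m → ℝ)) := by
    obtain ⟨t, ht, hsub⟩ := exists_finset_weights_subset_closure 𝒜 hfg
    have : ω = Submodule.span ℝ≥0 ((t.image (embM m) : Finset _) : Set (Fin m → ℝ)) := by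
      rw [Finset.coe_image]
      refine le_antisymm (Submodule.span_le.2 ?_) (Submodule.span_mono (Set.image_mono ht))
      rintro _ ⟨u, hu, rfl⟩
      have hucl := hsub hu
      clear hu
      change embMHom m u ∈ _
      induction hucl using AddSubmonoid.closure_induction with
      | mem u hu => exact Submodule.subset_span ⟨u, hu, rfl⟩
      | zero => rw [map_zero]; exact zero_mem _
      | add u v _ _ hu hv => rw [map_add]; exact add_mem hu hv
    rw [this]
    exact isClosed_span_nnreal_finset _
  apply Set.Subset.antisymm
  · intro q hq
    have hsub : (Submodule.span ℝ≥0 (embG m n '' (valueSemigroup ν Ver : Set _)) : Set _) ⊆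
        (σ : Set ((Fin m → ℝ) × (Fin n → ℝ))) ∩ {x | ∀ i, pairR (c i) x.1 = 0} := by
      refine Set.subset_inter (Submodule.span_mono (Set.image_mono ?_)) ?_
      · rw [hvalVer]
        exact fun s hs => hs.1
      · have : Submodule.span ℝ≥0 (embG m n '' (valueSemigroup ν Ver : Set _)) ≤
            ⨅ i, (LinearMap.ker (pairR (c i) ∘ₗ LinearMap.fst ℝ (Fin m → ℝ) (Fin n → ℝ))
              ).restrictScalars ℝ≥0 := by
          rw [Submodule.span_le, hvalVer]
          rintro _ ⟨s, hs, rfl⟩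
          rw [SetLike.mem_coe, Submodule.mem_iInf]
          intro i
          change pairR (c i) (embMHom m s.1) = 0
          rw [pairR_embMHom, hs.2 i, Int.cast_zero]
        intro x hx i
        exact (Submodule.mem_iInf _).1 (this hx) i
    have hqσ : q ∈ closure (σ : Set _) := closure_mono (hsub.trans Set.inter_subset_left) hq
    have hqc : ∀ i, pairR (c i) q.1 = 0 := by
      have hcl : IsClosed {x : (Fin m → ℝ) × (Fin n → ℝ) | ∀ i, pairR (c i) x.1 = 0} := by
        simp only [Set.ofPred_forall]
        exact isClosed_iInter fun i => isClosed_eq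
          ((pairR (c i)).continuous_of_finiteDimensional.comp continuous_fst) continuous_const
      exact closure_minimal (hsub.trans Set.inter_subset_right) hcl hq
    refine ⟨?_, hqσ⟩
    have hqω : q.1 ∈ ω := by
      refine closure_minimal (fun x hx => ?_) (hωclosed.preimage continuous_fst) hqσ
      change π x ∈ ω
      rw [← hmap]
      exact Submodule.mem_map_of_mem hx
    have := mem_span_section W (embMHom m) (fun i => pairZ (c i)) (fun i => pairR (c i))
      (fun i u => pairR_embMHom (c i) u) (x := q.1) (by rw [hW]; exact hqω) hqc
    have hsubU : {u | u ∈ W ∧ ∀ i, pairZ (c i) u = 0} ⊆ {u | 𝒜 u ≠ ⊥ ∧ P u} :=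
      fun u hu => ⟨hW.subset hu.1, hu.2⟩
    exact Submodule.span_mono (Set.image_mono hsubU) this
  · rintro q ⟨hqω, hqσ⟩
    have hqc : ∀ i, pairR (c i) q.1 = 0 := by
      have : Submodule.span ℝ≥0 (embM m '' {u | 𝒜 u ≠ ⊥ ∧ P u}) ≤
          ⨅ i, (LinearMap.ker (pairR (c i))).restrictScalars ℝ≥0 := by
        rw [Submodule.span_le]
        rintro _ ⟨u, hu, rfl⟩
        rw [SetLike.mem_coe, Submodule.mem_iInf]
        intro i
        change pairR (c i) (embMHom m u) = 0
        rw [pairR_embMHom, show pairZ (c i) u = 0 from hu.2 i, Int.cast_zero]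
      intro i
      exact (Submodule.mem_iInf _).1 (this hqω) i
    obtain ⟨p₀, hp₀, hadd₀⟩ := exists_add_smul_mem_span
      (embG m n '' (valueSemigroup ν (Set.univ : Set R) : Set _))
    obtain ⟨x₀, hx₀H, hx₀⟩ := hmeet
    have hp₀ω : p₀.1 ∈ ω := by
      rw [← hmap]
      exact Submodule.mem_map_of_mem (f := π) hp₀
    obtain ⟨δ, hδ, hmem⟩ := exists_sub_smul_mem_of_mem_intrinsicInterior ω hx₀ hp₀ω
    rw [← hmap] at hmem
    obtain ⟨z, hz, hzx⟩ := hmem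
    set p := z + δ • p₀ with hp
    have hp1 : p.1 = x₀ := by
      rw [hp, Prod.fst_add, Prod.smul_fst, show z.1 = x₀ - δ • p₀.1 from hzx, sub_add_cancel]
    have hin : ∀ ε : ℝ, 0 < ε →
        q + ε • p ∈ Submodule.span ℝ≥0 (embG m n '' (valueSemigroup ν Ver : Set _)) := by
      intro ε hε
      rw [hvalVer]
      refine mem_span_section _ (embGHom m n)
        (fun i => (pairZ (c i)).comp (AddMonoidHom.fst _ _))
        (fun i => pairR (c i) ∘ₗ LinearMap.fst ℝ _ _)
        (fun i s => pairR_embMHom (c i) s.1) ?_ fun i => ?_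
      · have : q + ε • p = (q + (ε * δ) • p₀) + ε • z := by
          rw [hp, smul_add, smul_smul]
          abel
        rw [this]
        exact add_mem (hadd₀ q hqσ _ (mul_pos hε hδ)) (smul_mem_of_nonneg _ hε.le hz)
      · change pairR (c i) (q.1 + ε • p.1) = 0
        rw [map_add, map_smul, hqc i, hp1, show pairR (c i) x₀ = 0 from hx₀H i, smul_zero, add_zero]
    have hlim : Filter.Tendsto (fun ε : ℝ => q + ε • p) (nhdsWithin 0 (Set.Ioi 0)) (nhds q) := by
      have hcont : Continuous fun ε : ℝ => q + ε • p := by fun_prop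
      have := hcont.tendsto 0
      rw [zero_smul, add_zero] at this
      exact this.mono_left nhdsWithin_le_nhds
    exact mem_closure_of_tendsto hlim (Filter.eventually_of_mem self_mem_nhdsWithin hin)

end
end

section
/- Let v₁, …, v_r ∈ ℤᵐ be vectors that are linearly independent over ℚ (so the cone they span is simplicial), and for each i let ray(vᵢ) := {u ∈ ℤᵐ : u = q·vᵢ in ℚᵐ for some rational q ≥ 0}. Assume R is generated as a K-algebra by homogeneous elements whose degrees lie in ⋃ᵢ ray(vᵢ), i.e. the K-subalgebra generated by ⋃ᵢ ⋃_{u ∈ ray(vᵢ)} 𝒜 u is all of R. Fix i, and let x ∈ FractionRing R be homogeneous of degree w for some w ∈ ray(vᵢ). Then x is integral over (the image of) R if and only if x is integral over (the image of) the Veronese subalgebra R(ray(vᵢ)). (This is the element-wise form of Lemma 3.6(2) of the paper.) -/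
noncomputable section

variable {K R : Type} [Field K] [CommRing R] [IsDomain R] [Algebra K R]
variable {m : ℕ}

/-- An element of the fraction field is homogeneous of degree `w` if it is a quotient of
homogeneous elements whose degrees differ by `w`. -/
def IsHomogeneousOfDegree (𝒜 : (Fin m → ℤ) → Submodule K R) (x : FractionRing R)
    (w : Fin m → ℤ) : Prop :=
  ∃ (a b : R) (u v : Fin m → ℤ), a ∈ 𝒜 u ∧ b ∈ 𝒜 v ∧ b ≠ 0 ∧ u - v = w ∧
    x = algebraMap R (FractionRing R) a / algebraMap R (FractionRing R) b

/-- `x` satisfies a monic polynomial equation with coefficients in the set `S`,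
i.e. `x` is integral over `S`. -/
def IsIntegralOverSet {F : Type} [CommRing F] (S : Set F) (x : F) : Prop :=
  ∃ n : ℕ, 0 < n ∧ ∃ c : ℕ → F, (∀ i, c i ∈ S) ∧
    x ^ n + ∑ i ∈ Finset.range n, c i * x ^ i = 0

/-- The set of lattice points `u ∈ ℤᵐ` lying on the nonnegative rational ray through `v`. -/
def rayZ {m : ℕ} (v : Fin m → ℤ) : Set (Fin m → ℤ) :=
  {u | ∃ q : ℚ, 0 ≤ q ∧ ∀ i, ((u i : ℤ) : ℚ) = q * ((v i : ℤ) : ℚ)}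

theorem nsmul_mem_rayZ {v w : Fin m → ℤ} (hw : w ∈ rayZ v) (k : ℕ) : k • w ∈ rayZ v := by
  obtain ⟨q, hq, h⟩ := hw
  refine ⟨k * q, by positivity, fun i => ?_⟩
  simp [h i, mul_assoc]

/-- The degree `n • u` part of a homogenized integral equation is again such an equation, with
coefficients of degree `(n - j) • (u - v)`. -/
theorem pow_add_sum_decompose_eq_zero {S : Type*} [CommRing S] [Algebra K S]
    (𝒜 : (Fin m → ℤ) → Submodule K S) [GradedAlgebra 𝒜]
    {a b : S} {u v : Fin m → ℤ} (ha : a ∈ 𝒜 u) (hb : b ∈ 𝒜 v) (n : ℕ) (d : ℕ → S)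
    (h : a ^ n + ∑ j ∈ Finset.range n, d j * (a ^ j * b ^ (n - j)) = 0) :
    a ^ n + ∑ j ∈ Finset.range n,
      (DirectSum.decompose 𝒜 (d j) ((n - j) • (u - v)) : S) * (a ^ j * b ^ (n - j)) = 0 := by
  have key := congrArg (fun z => (DirectSum.decompose 𝒜 z (n • u) : S)) h
  simp only [DirectSum.decompose_add, DirectSum.decompose_sum, DirectSum.decompose_zero,
    DirectSum.add_apply, DirectSum.sum_apply, DirectSum.zero_apply, Submodule.coe_add,
    AddSubmonoidClass.coe_finsetSum, ZeroMemClass.coe_zero] at key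
  rw [DirectSum.decompose_of_mem_same 𝒜 (SetLike.pow_mem_graded n ha)] at key
  rw [← key]
  congr 1
  refine Finset.sum_congr rfl fun j hj => ?_
  have hjn : j ≤ n := (Finset.mem_range.mp hj).le
  have hdeg : n • u = (n - j) • (u - v) + (j • u + (n - j) • v) := by
    rw [smul_sub, sub_add_add_cancel, ← add_smul, Nat.sub_add_cancel hjn]
  rw [hdeg, DirectSum.coe_decompose_mul_add_of_right_mem 𝒜
    (SetLike.mul_mem_graded (SetLike.pow_mem_graded j ha) (SetLike.pow_mem_graded (n - j) hb))]

/-- Clearing denominators in an integral equation for a fraction. -/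
theorem div_pow_add_sum_eq_zero_iff {a b : R} (hb : b ≠ 0) (n : ℕ) (d : ℕ → R) :
    (algebraMap R (FractionRing R) a / algebraMap R (FractionRing R) b) ^ n +
        ∑ j ∈ Finset.range n, algebraMap R (FractionRing R) (d j) *
          (algebraMap R (FractionRing R) a / algebraMap R (FractionRing R) b) ^ j = 0 ↔
      a ^ n + ∑ j ∈ Finset.range n, d j * (a ^ j * b ^ (n - j)) = 0 := by
  have hinj := IsFractionRing.injective R (FractionRing R)
  have hb' : algebraMap R (FractionRing R) b ≠ 0 := (map_ne_zero_iff _ hinj).mpr hb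
  rw [← map_eq_zero_iff _ hinj, ← mul_left_inj' (pow_ne_zero n hb'), zero_mul]
  simp only [map_add, map_sum, map_mul, map_pow, add_mul, Finset.sum_mul]
  rw [div_pow, div_mul_cancel₀ _ (pow_ne_zero n hb')]
  refine iff_of_eq (congrArg (· = 0) (congrArg _ (Finset.sum_congr rfl fun j hj => ?_)))
  rw [div_pow, ← pow_sub_mul_pow _ (Finset.mem_range.mp hj).le]
  field_simp

/-- **Lemma 3.6(2), element-wise form.** Suppose the `ℤᵐ`-graded domain `R` is generated by
homogeneous elements whose degrees lie on the rays of a simplicial cone, spanned by vectors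
`v₁, …, v_r` which are linearly independent over `ℚ`. Fix `i`, and let `x` in the fraction
field be homogeneous of degree `w ∈ ray(vᵢ)`. Then `x` is integral over (the image of) `R`
iff `x` is integral over (the image of) the Veronese subalgebra `R(ray(vᵢ))`. -/
theorem integral_iff_integral_veronese_ray
    (𝒜 : (Fin m → ℤ) → Submodule K R) [GradedAlgebra 𝒜]
    (r : ℕ) (v : Fin r → (Fin m → ℤ))
    (hindep : LinearIndependent ℚ (fun i => (fun j => ((v i j : ℤ) : ℚ)) : Fin r → (Fin m → ℚ)))
    (hgen : Algebra.adjoin K (⋃ i, ⋃ u ∈ rayZ (v i), (𝒜 u : Set R)) = (⊤ : Subalgebra K R))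
    (i : Fin r) (w : Fin m → ℤ) (hw : w ∈ rayZ (v i))
    (x : FractionRing R) (hx : IsHomogeneousOfDegree 𝒜 x w) :
    IsIntegralOverSet (Set.range (algebraMap R (FractionRing R))) x ↔
      IsIntegralOverSet
        (algebraMap R (FractionRing R) ''
          ((veronese 𝒜 (rayZ (v i)) : Subalgebra K R) : Set R)) x := by
  constructor
  · rintro ⟨n, hn, c, hc, h⟩
    obtain ⟨a, b, u, v', ha, hb, hb0, rfl, rfl⟩ := hx
    choose d hd using hc
    simp only [← hd] at h
    refine ⟨n, hn, fun j => algebraMap R (FractionRing R)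
      (DirectSum.decompose 𝒜 (d j) ((n - j) • (u - v'))), fun j => ⟨_, ?_, rfl⟩, ?_⟩
    · exact Algebra.subset_adjoin
        (Set.mem_biUnion (nsmul_mem_rayZ hw (n - j)) (SetLike.coe_mem _))
    · rw [div_pow_add_sum_eq_zero_iff hb0] at h ⊢
      exact pow_add_sum_decompose_eq_zero 𝒜 ha hb n d h
  · rintro ⟨n, hn, c, hc, h⟩
    exact ⟨n, hn, c, fun j => Set.image_subset_range _ _ (hc j), h⟩

end
end

section
/- With notation as in the context, let ν be a homogeneous valuation on R of full rank and let ν̂ be its extension to the nonzero elements of the fraction field. Then the valuation cone of R equals the valuation cone of its normalization: the closure in ℝᵐ⁺ⁿ of the ℝ≥0-span of the image of ν(R \ {0}) equals the closure of the ℝ≥0-span of the image of ν̂((integralClosure R F) \ {0}). (Proposition 3.8 of the paper.) -/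
open scoped NNReal

noncomputable section

variable {K R : Type} [Field K] [IsAlgClosed K] [CommRing R] [IsDomain R] [Algebra K R]
variable {m n : ℕ}

theorem embG_add (a b : (Fin m → ℤ) × (Fin n → ℤ)) :
    embG m n (a + b) = embG m n a + embG m n b := by
  ext <;> simp [embG]

theorem embG_nsmul (k : ℕ) (a : (Fin m → ℤ) × (Fin n → ℤ)) :
    embG m n (k • a) = k • embG m n a := by
  ext <;> simp [embG]

/-- A cone containing the points `a + k • v` for all `k : ℕ` has `v` in its closure. -/
theorem Submodule.mem_closure_of_forall_add_nsmul_mem {E : Type*} [AddCommGroup E] [Module ℝ E]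
    [TopologicalSpace E] [ContinuousAdd E] [ContinuousSMul ℝ E]
    (C : Submodule ℝ≥0 E) {a v : E} (h : ∀ k : ℕ, a + k • v ∈ C) :
    v ∈ closure (C : Set E) := by
  have hlim : Filter.Tendsto (fun k : ℕ => (1 / ((k : ℝ) + 1)) • a + v) Filter.atTop (nhds v) := by
    simpa using
      ((tendsto_one_div_add_atTop_nhds_zero_nat (𝕜 := ℝ)).smul_const a).add_const v
  refine mem_closure_of_tendsto hlim (Filter.Eventually.of_forall fun k => ?_)
  have hk : ((k : ℝ) + 1) ≠ 0 := by positivity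
  have hmem := C.smul_mem (1 / ((k : ℝ≥0) + 1)) (h (k + 1))
  have heq : (1 / ((k : ℝ≥0) + 1)) • (a + (k + 1) • v) = (1 / ((k : ℝ) + 1)) • a + v := by
    rw [NNReal.smul_def, smul_add, ← Nat.cast_smul_eq_nsmul ℝ, smul_smul]
    push_cast
    rw [one_div_mul_cancel hk, one_smul]
  rwa [heq] at hmem

/-- A multiplicative-to-additive function on the nonzero elements of a domain turns powers into
multiples, up to a fixed nonzero factor. -/
theorem map_mul_pow_of_map_mul {F Γ : Type*} [CommRing F] [IsDomain F] [AddCommMonoid Γ]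
    {w : F → Γ} (hw : ∀ x y : F, x ≠ 0 → y ≠ 0 → w (x * y) = w x + w y)
    {c x : F} (hc : c ≠ 0) (hx : x ≠ 0) (k : ℕ) : w (c * x ^ k) = w c + k • w x := by
  induction k with
  | zero => simp
  | succ k ih =>
    rw [pow_succ, ← mul_assoc, hw _ _ (mul_ne_zero hc (pow_ne_zero k hx)) hx, ih, succ_nsmul,
      add_assoc]

/-- **Proposition 3.8.** Let `R` be a finitely generated `ℤᵐ`-graded domain over an
algebraically closed field with `R₀ = K`, `ν` a homogeneous valuation of full rank on `R`,
and `ν̂` its extension to the fraction field. Then the valuation cone of `R` (the closure of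
the `ℝ≥0`-span of the image of the value semigroup) equals the valuation cone of the
normalization of `R`. -/
theorem valuationCone_eq_valuationCone_normalization
    (𝒜 : (Fin m → ℤ) → Submodule K R) [GradedAlgebra 𝒜]
    (hfg : Algebra.FiniteType K R)
    (h0 : 𝒜 0 = Submodule.span K {(1 : R)})
    (le : ((Fin m → ℤ) × (Fin n → ℤ)) → ((Fin m → ℤ) × (Fin n → ℤ)) → Prop)
    (hlin : IsLinearOrder _ le)
    (hinv : ∀ a b c, le a b → le (c + a) (c + b))
    (ν : R → (Fin m → ℤ) × (Fin n → ℤ))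
    (hmul : ∀ f g : R, f ≠ 0 → g ≠ 0 → ν (f * g) = ν f + ν g)
    (hadd : ∀ f g : R, f ≠ 0 → g ≠ 0 → f + g ≠ 0 →
      le (ν f) (ν (f + g)) ∨ le (ν g) (ν (f + g)))
    (hconst : ∀ c : K, c ≠ 0 → ν (algebraMap K R c) = 0)
    (hhom : ∀ f : R, f ≠ 0 →
      (∃ u, ((DirectSum.decompose 𝒜 f u : 𝒜 u) : R) ≠ 0 ∧
        ν f = ν ((DirectSum.decompose 𝒜 f u : 𝒜 u) : R)) ∧
      ∀ u, ((DirectSum.decompose 𝒜 f u : 𝒜 u) : R) ≠ 0 →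
        le (ν f) (ν ((DirectSum.decompose 𝒜 f u : 𝒜 u) : R)))
    -- `ν` has full rank
    (hrank : AddSubgroup.closure (ν '' {f : R | f ≠ 0}) =
        (⊤ : AddSubgroup ((Fin m → ℤ) × (Fin n → ℤ))))
    (hdim : ringKrullDim R = ((m + n : ℕ) : WithBot ℕ∞))
    -- `ν̂` is the extension of `ν` to the fraction field
    (ν' : FractionRing R → (Fin m → ℤ) × (Fin n → ℤ))
    (hext : ∀ x : R, x ≠ 0 → ν' (algebraMap R (FractionRing R) x) = ν x)
    (hmul' : ∀ x y : FractionRing R, x ≠ 0 → y ≠ 0 → ν' (x * y) = ν' x + ν' y) :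
    closure ((Submodule.span ℝ≥0 (embG m n '' (ν '' {f : R | f ≠ 0}))
        : Submodule ℝ≥0 ((Fin m → ℝ) × (Fin n → ℝ))) : Set ((Fin m → ℝ) × (Fin n → ℝ))) =
      closure ((Submodule.span ℝ≥0 (embG m n ''
          (ν' '' {x : FractionRing R | x ∈ integralClosure R (FractionRing R) ∧ x ≠ 0}))
        : Submodule ℝ≥0 ((Fin m → ℝ) × (Fin n → ℝ))) : Set ((Fin m → ℝ) × (Fin n → ℝ))) := by
  set C := Submodule.span ℝ≥0 (embG m n '' (ν '' {f : R | f ≠ 0}))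
  have hinj := IsFractionRing.injective R (FractionRing R)
  refine subset_antisymm (closure_mono (Submodule.span_mono (Set.image_mono ?_))) ?_
  · rintro _ ⟨f, hf, rfl⟩
    exact ⟨algebraMap R _ f, ⟨isIntegral_algebraMap, (map_ne_zero_iff _ hinj).2 hf⟩, hext f hf⟩
  · refine closure_minimal ?_ isClosed_closure
    rw [← Submodule.topologicalClosure_coe, SetLike.coe_subset_coe, Submodule.span_le]
    rintro _ ⟨_, ⟨x, ⟨hx, hx0⟩, rfl⟩, rfl⟩
    obtain ⟨c, hc, hcx⟩ := IsIntegral.isAlmostIntegral hx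
    have hc0 : algebraMap R (FractionRing R) c ≠ 0 :=
      (map_ne_zero_iff _ hinj).2 (nonZeroDivisors.ne_zero hc)
    refine C.mem_closure_of_forall_add_nsmul_mem
      (a := embG m n (ν' (algebraMap R (FractionRing R) c))) fun k => ?_
    obtain ⟨r, hr⟩ := hcx k
    rw [Algebra.smul_def] at hr
    have hr0 : r ≠ 0 := by
      rintro rfl
      exact mul_ne_zero hc0 (pow_ne_zero k hx0) (by rw [← hr, map_zero])
    rw [← embG_nsmul, ← embG_add, ← map_mul_pow_of_map_mul hmul' hc0 hx0, ← hr, hext r hr0]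
    exact Submodule.subset_span ⟨_, ⟨r, hr0, rfl⟩, rfl⟩

end
end

section
/- Let K be an algebraically closed field, let d ≥ 1, and let L ⊆ Sym^d be a K-subspace with 3 ≤ finrank_K L which has degree d and arithmetic genus g (i.e. finrank_K(L^k) = d·k + 1 − g for all sufficiently large k) with g ≤ 1. Then there exists Q = (α, β) ∈ K × K with (α, β) ≠ (0, 0) such that the value semigroup S(L, Q) is finitely generated, i.e. R(L) admits a Khovanskii-finite homogeneous valuation. (First part of Theorem 4.11 of the paper.) -/
open MvPolynomial Filter

noncomputable section

variable {K : Type} [Field K]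

/-- The linear form `β·s − α·t` in `K[s,t]`, cutting out the point `Q = (α : β)` of `ℙ¹`. -/
def lform (α β : K) : MvPolynomial (Fin 2) K := C β * X 0 - C α * X 1

/-- The value semigroup `S(L, Q) = {(k, ord_Q f) : f ∈ L^k, f ≠ 0}` of the homogeneous
valuation `ν_Q` on `R(L) = ⨁ₖ L^k`, where `ord_Q f` is the largest `e` such that
`(β·s − α·t)^e` divides `f`. -/
def curveValueSemigroup (L : Submodule K (MvPolynomial (Fin 2) K)) (α β : K) :
    AddSubmonoid (ℤ × ℤ) :=
  AddSubmonoid.closure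
    {p | ∃ (k e : ℕ) (f : MvPolynomial (Fin 2) K), f ∈ L ^ k ∧ f ≠ 0 ∧
      (lform α β) ^ e ∣ f ∧ ¬ (lform α β) ^ (e + 1) ∣ f ∧ p = ((k : ℤ), (e : ℤ))}

theorem isHomogeneous_lform (α β : K) : (lform α β).IsHomogeneous 1 :=
  (isHomogeneous_C_mul_X β 0).sub (isHomogeneous_C_mul_X α 1)

theorem lform_ne_zero {α β : K} (h : (α, β) ≠ ((0 : K), (0 : K))) : lform α β ≠ 0 := by
  intro h0
  apply h
  have h1 := congrArg (eval ![1, 0]) h0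
  have h2 := congrArg (eval ![0, 1]) h0
  simp [lform] at h1 h2
  simp [h1, h2]

/-- Binary forms of degree `N` are spanned by the monomials `s ^ (N - i) * t ^ i`. -/
theorem homogeneousSubmodule_le_span (N : ℕ) :
    homogeneousSubmodule (Fin 2) K N ≤ Submodule.span K
      (Set.range fun i : Fin (N + 1) ↦ (X 0 ^ (N - i : ℕ) * X 1 ^ (i : ℕ) :
        MvPolynomial (Fin 2) K)) := by
  intro f hf
  rw [f.as_sum]
  refine Submodule.sum_mem _ fun m hm ↦ ?_
  have hdeg : m 0 + m 1 = N := by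
    have := ((mem_homogeneousSubmodule _ _).1 hf).degree_eq_sum_deg_support hm
    rw [this, ← Finsupp.degree_apply, Finsupp.degree_eq_sum, Fin.sum_univ_two]
  have hmon : monomial m (coeff m f) =
      coeff m f • (X 0 ^ (N - m 1) * X 1 ^ (m 1) : MvPolynomial (Fin 2) K) := by
    rw [monomial_eq, Finsupp.prod_fintype _ _ (by simp), Fin.prod_univ_two, smul_eq_C_mul,
      show N - m 1 = m 0 by omega]
  rw [hmon]
  exact Submodule.smul_mem _ _ (Submodule.subset_span ⟨⟨m 1, by omega⟩, rfl⟩)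

instance finite_homogeneousSubmodule (N : ℕ) :
    Module.Finite K (homogeneousSubmodule (Fin 2) K N) :=
  Module.Finite.iff_fg.2 (homogeneousSubmodule_fg _ _ N)

theorem finrank_homogeneousSubmodule_le (N : ℕ) :
    Module.finrank K (homogeneousSubmodule (Fin 2) K N) ≤ N + 1 := by
  have : Module.Finite K (Submodule.span K
      (Set.range fun i : Fin (N + 1) ↦ (X 0 ^ (N - i : ℕ) * X 1 ^ (i : ℕ) :
        MvPolynomial (Fin 2) K))) :=
    Module.Finite.span_of_finite K (Set.finite_range _)
  refine (Submodule.finrank_mono (homogeneousSubmodule_le_span N)).trans ?_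
  exact (finrank_range_le_card _).trans (by simp)

/-- A subspace of codimension at most one contains the kernel of some linear functional. -/
theorem exists_dual_ker_le {V : Type*} [AddCommGroup V] [Module K V] [Module.Finite K V]
    (W : Submodule K V) (h : Module.finrank K V ≤ Module.finrank K W + 1) :
    ∃ φ : V →ₗ[K] K, ∀ v, φ v = 0 → v ∈ W := by
  have hq : Module.finrank K (V ⧸ W) ≤ 1 := by
    have := W.finrank_quotient_add_finrank
    omega
  obtain ⟨ψ, hψ⟩ : ∃ ψ : (V ⧸ W) →ₗ[K] K, Function.Injective ψ := by
    apply lift_rank_le_iff_exists_linearMap.1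
    rw [← Module.finrank_eq_rank, CommSemiring.rank_self]
    rw [Cardinal.lift_natCast, Cardinal.lift_one]
    exact_mod_cast hq
  refine ⟨ψ ∘ₗ W.mkQ, fun v hv ↦ ?_⟩
  rw [← W.ker_mkQ, LinearMap.mem_ker]
  exact hψ (by simpa using hv)

/-- Over an algebraically closed field every hyperplane in the space of binary forms of positive
degree `N` contains the `N`-th power of a nonzero linear form. -/
theorem exists_lform_pow_mem [IsAlgClosed K] {N : ℕ} (hN : 1 ≤ N)
    (W : Submodule K (MvPolynomial (Fin 2) K)) (hW : W ≤ homogeneousSubmodule (Fin 2) K N)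
    (hfin : N ≤ Module.finrank K W) :
    ∃ α β : K, (α, β) ≠ ((0 : K), (0 : K)) ∧ lform α β ^ N ∈ W := by
  have hsub : Module.finrank K (W.submoduleOf (homogeneousSubmodule (Fin 2) K N)) =
      Module.finrank K W := (Submodule.submoduleOfEquivOfLe hW).finrank_eq
  obtain ⟨φ, hφ⟩ := exists_dual_ker_le (W.submoduleOf (homogeneousSubmodule (Fin 2) K N))
    (by have := finrank_homogeneousSubmodule_le (K := K) N; omega)
  have hpow (α β : K) : lform α β ^ N ∈ homogeneousSubmodule (Fin 2) K N := by
    simpa using (isHomogeneous_lform α β).pow N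
  suffices h : ∃ α β : K, (α, β) ≠ ((0 : K), (0 : K)) ∧ φ ⟨_, hpow α β⟩ = 0 by
    obtain ⟨α, β, h0, h⟩ := h
    exact ⟨α, β, h0, hφ _ h⟩
  have hmon (i : ℕ) (hi : i ∈ Finset.range (N + 1)) :
      (X 1 ^ i * X 0 ^ (N - i) : MvPolynomial (Fin 2) K) ∈ homogeneousSubmodule (Fin 2) K N := by
    have := (isHomogeneous_X_pow (R := K) (1 : Fin 2) i).mul
      (isHomogeneous_X_pow (R := K) (0 : Fin 2) (N - i))
    rwa [Nat.add_sub_cancel' (Finset.mem_range_succ_iff.1 hi)] at this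
  let c (i : ℕ) : K := if hi : i ∈ Finset.range (N + 1) then φ ⟨_, hmon i hi⟩ else 0
  let p : Polynomial K := ∑ i ∈ Finset.range (N + 1),
    Polynomial.monomial i ((-1) ^ i * (N.choose i : K) * c i)
  have hp (α : K) : φ ⟨_, hpow α 1⟩ = p.eval α := by
    have hexp : (⟨_, hpow α 1⟩ : homogeneousSubmodule (Fin 2) K N) =
        ∑ i ∈ (Finset.range (N + 1)).attach,
          ((-1) ^ i.1 * (N.choose i : K) * α ^ i.1) • ⟨_, hmon i.1 i.2⟩ := by
      apply Subtype.ext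
      simp only [Submodule.coe_sum, Submodule.coe_smul]
      rw [Finset.sum_attach (Finset.range (N + 1)) fun i ↦
          ((-1) ^ i * (N.choose i : K) * α ^ i) •
            (X 1 ^ i * X 0 ^ (N - i) : MvPolynomial (Fin 2) K)]
      rw [lform, show (C 1 * X 0 - C α * X 1 : MvPolynomial (Fin 2) K) =
        C (-α) * X 1 + X 0 by simp; ring, add_pow]
      refine Finset.sum_congr rfl fun i _ ↦ ?_
      rw [smul_eq_C_mul, mul_pow, neg_pow]
      simp only [map_mul, map_pow, map_neg, map_one, map_natCast]
      ring
    rw [hexp, map_sum, Polynomial.eval_finsetSum, ← Finset.sum_attach (Finset.range (N + 1))]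
    refine Finset.sum_congr rfl fun i _ ↦ ?_
    simp only [map_smul, smul_eq_mul, Polynomial.eval_monomial, c, dif_pos i.2]
    ring
  by_cases hdeg : p.degree = 0
  · refine ⟨1, 0, by simp, ?_⟩
    have hcoeff : p.coeff N = (-1) ^ N * c N := by
      simp [p, Polynomial.finsetSum_coeff, Polynomial.coeff_monomial]
    rw [Polynomial.coeff_eq_zero_of_degree_lt (by rw [hdeg]; exact_mod_cast hN)] at hcoeff
    have hc : c N = 0 := by simpa using hcoeff.symm
    have hexp : (⟨_, hpow 1 0⟩ : homogeneousSubmodule (Fin 2) K N) =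
        ((-1 : K) ^ N) • ⟨_, hmon N (by simp)⟩ := by
      apply Subtype.ext
      simp [lform, smul_eq_C_mul, neg_pow (X 1 : MvPolynomial (Fin 2) K)]
    rw [hexp, map_smul]
    simp only [c, Finset.self_mem_range_succ, dif_pos] at hc
    rw [hc, smul_zero]
  · obtain ⟨α, hα⟩ := IsAlgClosed.exists_root p hdeg
    exact ⟨α, 1, by simp, by rw [hp]; exact hα⟩

theorem exists_isHomogeneous_of_dvd {σ : Type*} {p f : MvPolynomial σ K} {m j : ℕ}
    (hp : p.IsHomogeneous m) (hf : f.IsHomogeneous (m + j)) (h : p ∣ f) :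
    ∃ q : MvPolynomial σ K, q.IsHomogeneous j ∧ f = p * q := by
  obtain ⟨q, rfl⟩ := h
  refine ⟨homogeneousComponent j q, homogeneousComponent_isHomogeneous j q, ?_⟩
  let : GradedAlgebra (homogeneousSubmodule σ K) := gradedAlgebra
  have hcomp (φ : MvPolynomial σ K) (i : ℕ) :
      (DirectSum.decompose (homogeneousSubmodule σ K) φ i : MvPolynomial σ K) =
        homogeneousComponent i φ := decomposition.decompose'_apply φ i
  have := DirectSum.coe_decompose_mul_add_of_left_mem (homogeneousSubmodule σ K) (i := m) (j := j)
    (b := q) ((mem_homogeneousSubmodule _ _).2 hp)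
  rwa [hcomp, hcomp, homogeneousComponent_eq_self hf] at this

theorem pow_le_homogeneousSubmodule {σ : Type*} {d : ℕ} {L : Submodule K (MvPolynomial σ K)}
    (hL : L ≤ homogeneousSubmodule σ K d) (k : ℕ) : L ^ k ≤ homogeneousSubmodule σ K (d * k) := by
  induction k with
  | zero =>
    rw [pow_zero, Submodule.one_le]
    exact isHomogeneous_one σ K
  | succ k ih =>
    rw [pow_succ, Submodule.mul_le]
    intro a ha b hb
    exact (ih ha).mul (hL hb)

theorem pow_dvd_of_mem_pow {A : Type*} [CommRing A] [Algebra K A] {L : Submodule K A} {p : A}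
    (hp : ∀ f ∈ L, p ∣ f) (k : ℕ) : ∀ f ∈ L ^ k, p ^ k ∣ f := by
  have h : L ^ k ≤ (Ideal.span {p ^ k}).restrictScalars K := by
    induction k with
    | zero => simp
    | succ k ih =>
      rw [pow_succ, Submodule.mul_le]
      intro a ha b hb
      have hka := Ideal.mem_span_singleton.1 (ih ha)
      simpa [Ideal.mem_span_singleton, pow_succ] using mul_dvd_mul hka (hp b hb)
  exact fun f hf ↦ Ideal.mem_span_singleton.1 (h hf)

/-- If some power `L ^ k` with `2 ≤ k` has codimension at most one, then `L` has no base point. -/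
theorem exists_not_lform_dvd {d : ℕ} (hd : 1 ≤ d) {L : Submodule K (MvPolynomial (Fin 2) K)}
    (hL : L ≤ homogeneousSubmodule (Fin 2) K d) {k : ℕ} (hk : 2 ≤ k)
    (hfin : d * k ≤ Module.finrank K ↥(L ^ k)) (α β : K) :
    ∃ f ∈ L, ¬ lform α β ∣ f := by
  by_contra! h
  have hkd : k ≤ d * k := Nat.le_mul_of_pos_left k hd
  have hle : L ^ k ≤ (homogeneousSubmodule (Fin 2) K (d * k - k)).map
      (LinearMap.mulLeft K (lform α β ^ k)) := by
    intro f hf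
    obtain ⟨q, hq, rfl⟩ := exists_isHomogeneous_of_dvd (m := k) (j := d * k - k)
      (by simpa using (isHomogeneous_lform α β).pow k)
      (by rw [Nat.add_sub_cancel' hkd]; exact pow_le_homogeneousSubmodule hL k hf)
      (pow_dvd_of_mem_pow h k f hf)
    exact ⟨q, hq, rfl⟩
  have h1 := Submodule.finrank_mono hle
  have h2 := Submodule.finrank_map_le (LinearMap.mulLeft K (lform α β ^ k))
    (homogeneousSubmodule (Fin 2) K (d * k - k))
  have h3 := finrank_homogeneousSubmodule_le (K := K) (d * k - k)
  omega

/-- A submonoid of `ℤ × ℤ` contained in the cone `0 ≤ e ≤ d * k` is finitely generated as soon as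
it contains a point on each of the two boundary rays. -/
theorem AddSubmonoid.fg_of_boundary_mem {d n : ℕ} (hd : 1 ≤ d) (hn : 1 ≤ n)
    (S : AddSubmonoid (ℤ × ℤ)) (hS : ∀ p ∈ S, 0 ≤ p.2 ∧ p.2 ≤ d * p.1)
    (h₁ : ((1 : ℤ), (0 : ℤ)) ∈ S) (h₂ : ((n : ℤ), ((d * n : ℕ) : ℤ)) ∈ S) : S.FG := by
  let emb (r : ℕ) (x : ℕ × ℕ) : ℤ × ℤ := (n * x.1 + x.2, (d * n : ℕ) * x.1 + r)
  let G (r : ℕ) : Set (ℕ × ℕ) := {x | Minimal (fun x ↦ emb r x ∈ S) x}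
  have hG (r : ℕ) : (G r).Finite :=
    WellQuasiOrderedLE.finite_of_isAntichain (setOfPred_minimal_antichain _)
  let T : Set (ℤ × ℤ) := {(1, 0), ((n : ℤ), ((d * n : ℕ) : ℤ))} ∪
    ⋃ r ∈ Finset.range (d * n), emb r '' G r
  have hT : T.Finite := (Set.toFinite _).union
    ((Finset.finite_toSet _).biUnion fun r _ ↦ (hG r).image _)
  refine (AddSubmonoid.fg_iff S).2 ⟨T, le_antisymm ?_ ?_, hT⟩
  · rw [AddSubmonoid.closure_le]
    rintro p (hp | hp)
    · rcases hp with rfl | rfl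
      exacts [h₁, h₂]
    · simp only [Set.mem_iUnion] at hp
      obtain ⟨r, _, x, hx, rfl⟩ := hp
      exact (Set.mem_ofPred.1 hx).prop
  · rintro ⟨k, e⟩ hp
    obtain ⟨he, hek⟩ := hS _ hp
    simp only at he hek
    lift e to ℕ using he
    have hdn : 0 < d * n := Nat.mul_pos hd hn
    have hmod : d * n * (e / (d * n)) + e % (d * n) = e := Nat.div_add_mod _ _
    have hk : (n : ℤ) * (e / (d * n) : ℕ) ≤ k := by
      have : (d : ℤ) * (n * (e / (d * n) : ℕ)) ≤ d * k := by
        refine le_trans ?_ hek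
        rw [← mul_assoc]
        exact_mod_cast Nat.mul_div_le e (d * n)
      exact le_of_mul_le_mul_left this (by exact_mod_cast hd)
    obtain ⟨m, hm⟩ := Int.eq_ofNat_of_zero_le (sub_nonneg.2 hk)
    have hemb : emb (e % (d * n)) (e / (d * n), m) = (k, (e : ℤ)) := by
      refine Prod.ext ?_ ?_
      · simp only [emb]; omega
      · simp only [emb]; exact_mod_cast hmod
    obtain ⟨⟨a, b⟩, hle, hmin⟩ := exists_minimal_le_of_wellFoundedLT
      (fun x ↦ emb (e % (d * n)) x ∈ S) (e / (d * n), m) (by rw [hemb]; exact hp)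
    obtain ⟨u, hu⟩ := Nat.exists_eq_add_of_le hle.1
    obtain ⟨v, hv⟩ := Nat.exists_eq_add_of_le hle.2
    simp only at hu hv
    have hsum : (k, (e : ℤ)) = v • ((1 : ℤ), (0 : ℤ)) +
        (u • ((n : ℤ), ((d * n : ℕ) : ℤ)) + emb (e % (d * n)) (a, b)) := by
      rw [← hemb, hu, hv]
      refine Prod.ext ?_ ?_ <;> simp [emb] <;> ring
    rw [hsum]
    have hmem₁ : ((1 : ℤ), (0 : ℤ)) ∈ T := by simp [T]
    have hmem₂ : ((n : ℤ), ((d * n : ℕ) : ℤ)) ∈ T := by simp [T]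
    have hmem : emb (e % (d * n)) (a, b) ∈ T := by
      refine Set.mem_union_right _ (Set.mem_biUnion (Finset.mem_range.2 (Nat.mod_lt e hdn)) ?_)
      exact Set.mem_image_of_mem _ (Set.mem_ofPred.2 hmin)
    exact add_mem (nsmul_mem (AddSubmonoid.subset_closure hmem₁) _)
      (add_mem (nsmul_mem (AddSubmonoid.subset_closure hmem₂) _)
        (AddSubmonoid.subset_closure hmem))

theorem le_of_lform_pow_dvd {α β : K} {f : MvPolynomial (Fin 2) K} {N e : ℕ} (hf : f.IsHomogeneous N) (hf0 : f ≠ 0)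
    (hdvd : lform α β ^ e ∣ f) : e ≤ N := by
  obtain ⟨q, rfl⟩ := hdvd
  have hpow := (isHomogeneous_lform α β).pow e
  rw [one_mul] at hpow
  rw [← hf.totalDegree hf0, totalDegree_mul_of_isDomain (left_ne_zero_of_mul hf0)
    (right_ne_zero_of_mul hf0), hpow.totalDegree (left_ne_zero_of_mul hf0)]
  exact Nat.le_add_right e _

theorem curveValueSemigroup_le_cone {d : ℕ} {L : Submodule K (MvPolynomial (Fin 2) K)}
    (hL : L ≤ homogeneousSubmodule (Fin 2) K d) (α β : K) :
    ∀ p ∈ curveValueSemigroup L α β, 0 ≤ p.2 ∧ p.2 ≤ d * p.1 := by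
  intro p hp
  induction hp using AddSubmonoid.closure_induction with
  | mem p hp =>
    obtain ⟨k, e, f, hf, hf0, hdvd, -, rfl⟩ := hp
    have := le_of_lform_pow_dvd (pow_le_homogeneousSubmodule hL k hf) hf0 hdvd
    exact ⟨Int.natCast_nonneg e, by simpa using (by exact_mod_cast this : (e : ℤ) ≤ d * k)⟩
  | zero => simp
  | add p q _ _ hp hq =>
    simp only [Prod.fst_add, Prod.snd_add, mul_add]
    exact ⟨add_nonneg hp.1 hq.1, add_le_add hp.2 hq.2⟩

/-- **Theorem 4.11, first part.** Let `L ⊆ Sym^d` be a subspace of dimension at least `3`,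
of degree `d` and arithmetic genus `g ≤ 1`. Then `R(L)` admits a Khovanskii-finite
homogeneous valuation: there is a point `Q = (α : β)` of `ℙ¹` such that the value semigroup
`S(L, Q)` is finitely generated. -/
theorem exists_khovanskiiFinite_of_genus_le_one [IsAlgClosed K] (d : ℕ) (hd : 1 ≤ d)
    (L : Submodule K (MvPolynomial (Fin 2) K))
    (hL : L ≤ MvPolynomial.homogeneousSubmodule (Fin 2) K d)
    (hdim : 3 ≤ Module.finrank K ↥L)
    (g : ℤ) (hg : g ≤ 1)
    -- `L` has degree `d` and arithmetic genus `g`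
    (hdeg : ∀ᶠ k : ℕ in atTop, (Module.finrank K ↥(L ^ k) : ℤ) = d * k + 1 - g) :
    ∃ α β : K, (α, β) ≠ ((0 : K), (0 : K)) ∧ (curveValueSemigroup L α β).FG := by
  obtain ⟨n, hn, hn2⟩ := (hdeg.and (eventually_ge_atTop 2)).exists
  have hfin : d * n ≤ Module.finrank K ↥(L ^ n) := by
    have : ((d * n : ℕ) : ℤ) ≤ Module.finrank K ↥(L ^ n) := by
      rw [hn]
      push_cast
      linarith
    exact_mod_cast this
  obtain ⟨α, β, h0, hmem⟩ := exists_lform_pow_mem (Nat.mul_pos hd (by omega : 0 < n)) (L ^ n)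
    (pow_le_homogeneousSubmodule hL n) hfin
  refine ⟨α, β, h0, AddSubmonoid.fg_of_boundary_mem hd (by omega : 1 ≤ n) _
    (curveValueSemigroup_le_cone hL α β) ?_ ?_⟩
  · obtain ⟨f, hf, hndvd⟩ := exists_not_lform_dvd hd hL hn2 hfin α β
    refine AddSubmonoid.subset_closure
      ⟨1, 0, f, by simpa using hf, ?_, by simp, by simpa using hndvd, by simp⟩
    rintro rfl
    exact hndvd (dvd_zero _)
  · have hne : lform α β ^ (d * n) ≠ 0 := pow_ne_zero _ (lform_ne_zero h0)
    refine AddSubmonoid.subset_closure ⟨n, d * n, _, hmem, hne, dvd_rfl, fun hdvd ↦ ?_, rfl⟩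
    have := le_of_lform_pow_dvd (pow_le_homogeneousSubmodule hL n hmem) hne hdvd
    omega

end
end
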